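/- Let n be a positive integer with n ≥ 125, n ≡ 2 (mod 5) and n ≡ 1 (mod 6). Then for every finite abelian group H of order n²+n+1 there exist no inverse-closed subsets T₀, T₁ of H with e ∈ T₀ satisfying the APLL group-ring equations. -/

import Mathlib

open scoped Classical Pointwise

/-- The APLL group-ring equations, stated via coefficient counts: for every `h ∈ H`,
`#{(a,b) ∈ T₀×T₁ : ab = h} = 1 − [h = e]`, and
`#{(a,b) ∈ T₀×T₀ : ab = h} + #{(a,b) ∈ T₁×T₁ : ab = h} + #{t ∈ T₀ : t² = h}
  + #{t ∈ T₁ : t² = h} = 2 + 2n·[h = e]`. -/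
def APLLEqs {H : Type*} [CommGroup H] (n : ℕ) (T₀ T₁ : Set H) : Prop :=
  (∀ h : H,
      {p : H × H | p.1 ∈ T₀ ∧ p.2 ∈ T₁ ∧ p.1 * p.2 = h}.ncard
        = if h = 1 then 0 else 1) ∧
  (∀ h : H,
      {p : H × H | p.1 ∈ T₀ ∧ p.2 ∈ T₀ ∧ p.1 * p.2 = h}.ncard
        + {p : H × H | p.1 ∈ T₁ ∧ p.2 ∈ T₁ ∧ p.1 * p.2 = h}.ncard
        + {t : H | t ∈ T₀ ∧ t ^ 2 = h}.ncard
        + {t : H | t ∈ T₁ ∧ t ^ 2 = h}.ncard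
        = 2 + if h = 1 then 2 * n else 0)

/-- `Xset T₀ T₁ i` is the set of `h ∈ H` appearing with coefficient `i` in `T̂⁽²⁾T₀`. -/
def Xset {H : Type*} [CommGroup H] (T₀ T₁ : Set H) (i : ℕ) : Set H :=
  {h : H | {p : H × H | p.1 ∈ T₀ ∪ T₁ ∧ p.2 ∈ T₀ ∧ p.1 ^ 2 * p.2 = h}.ncard = i}

/-- `Yset T₀ T₁ i` is the set of `h ∈ H` appearing with coefficient `i` in `T̂⁽²⁾T₁`. -/
def Yset {H : Type*} [CommGroup H] (T₀ T₁ : Set H) (i : ℕ) : Set H :=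
  {h : H | {p : H × H | p.1 ∈ T₀ ∪ T₁ ∧ p.2 ∈ T₁ ∧ p.1 ^ 2 * p.2 = h}.ncard = i}

/-- `Vset T₀ T₁ i` is the set of `h ∈ H` appearing with coefficient `i` in `T̂⁽⁴⁾T₁`. -/
def Vset {H : Type*} [CommGroup H] (T₀ T₁ : Set H) (i : ℕ) : Set H :=
  {h : H | {p : H × H | p.1 ∈ T₀ ∪ T₁ ∧ p.2 ∈ T₁ ∧ p.1 ^ 4 * p.2 = h}.ncard = i}

/-- `θ₀ = |(T₀T₀ ∖ T₀⁽²⁾) ∩ T̂⁽⁴⁾|`. -/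
noncomputable def theta0 {H : Type*} [CommGroup H] (T₀ T₁ : Set H) : ℕ :=
  (((T₀ * T₀) \ ((fun t => t ^ 2) '' T₀)) ∩ ((fun g => g ^ 4) '' (T₀ ∪ T₁))).ncard

/-- `θ₁ = |T₁ ∩ T̂⁽²⁾|/2 + |(T₁T₁ ∖ (T₁⁽²⁾ ∪ {e})) ∩ T̂⁽⁴⁾|`, as a rational number. -/
noncomputable def theta1 {H : Type*} [CommGroup H] (T₀ T₁ : Set H) : ℚ :=
  ((T₁ ∩ ((fun g => g ^ 2) '' (T₀ ∪ T₁))).ncard : ℚ) / 2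
    + ((((T₁ * T₁) \ (((fun t => t ^ 2) '' T₁) ∪ {1}))
        ∩ ((fun g => g ^ 4) '' (T₀ ∪ T₁))).ncard : ℚ)

/-- `s_i = (i−1)(i−4)/2` if `i ≡ 1 (mod 3)`, and `(i−2)(i−3)/2` otherwise. -/
def sCoef (i : ℕ) : ℚ :=
  if i % 3 = 1 then ((i : ℚ) - 1) * ((i : ℚ) - 4) / 2
  else ((i : ℚ) - 2) * ((i : ℚ) - 3) / 2

/-- The sum of the values of a complex character over a subset of a finite group. -/
noncomputable def charSum {H : Type*} [CommGroup H] [Fintype H] (χ : H →* ℂˣ) (T : Set H) : ℂ :=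
  ∑ t ∈ T.toFinset, (χ t : ℂ)

theorem sum_ncard_fiber_mul {ι H : Type*} [Fintype ι] [Fintype H] (S : Finset ι) (f : ι → H)
    (F : H → ℂ) :
    ∑ h, ({p | p ∈ S ∧ f p = h}.ncard : ℂ) * F h = ∑ p ∈ S, F (f p) := by
  rw [← Finset.sum_fiberwise S f]
  refine Finset.sum_congr rfl fun h _ => ?_
  have hset : {p | p ∈ S ∧ f p = h} = ((S.filter fun p => f p = h : Finset ι) : Set ι) := by
    ext; simp
  rw [hset, Set.ncard_coe_finset,
    Finset.sum_congr rfl fun p hp => by rw [(Finset.mem_filter.1 hp).2]]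
  simp

theorem char_sq_eq_inv {H : Type*} [CommGroup H] {χ : H →* ℂˣ} (h3 : χ ^ 3 = 1) (t : H) :
    (χ t : ℂ) ^ 2 = (χ t : ℂ)⁻¹ := by
  have h : (χ t : ℂ) ^ 3 = 1 := by
    simpa using congrArg Units.val (DFunLike.congr_fun h3 t)
  exact eq_inv_of_mul_eq_one_left (by rw [← h]; ring)

section

variable {H : Type*} [CommGroup H] [Fintype H] (χ : H →* ℂˣ)

theorem sum_ncard_prod_mul_char (A B : Set H) :
    ∑ h, ({p : H × H | p.1 ∈ A ∧ p.2 ∈ B ∧ p.1 * p.2 = h}.ncard : ℂ) * (χ h : ℂ)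
      = charSum χ A * charSum χ B := by
  rw [charSum, charSum, Finset.sum_mul_sum, ← Finset.sum_product']
  have := sum_ncard_fiber_mul (A.toFinset ×ˢ B.toFinset) (fun p => p.1 * p.2)
    (fun h => (χ h : ℂ))
  simpa [and_assoc] using this

theorem sum_ncard_sq_mul_char (A : Set H) :
    ∑ h, ({t : H | t ∈ A ∧ t ^ 2 = h}.ncard : ℂ) * (χ h : ℂ)
      = ∑ t ∈ A.toFinset, (χ t : ℂ) ^ 2 := by
  have := sum_ncard_fiber_mul A.toFinset (fun t => t ^ 2) (fun h => (χ h : ℂ))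
  simpa using this

theorem charSum_eq_sum_inv {T : Set H} (hT : T⁻¹ = T) :
    charSum χ T = ∑ t ∈ T.toFinset, (χ t : ℂ)⁻¹ := by
  refine Finset.sum_nbij' (fun t => t⁻¹) (fun t => t⁻¹) ?_ ?_ ?_ ?_ ?_
  · intro t ht
    rw [Set.mem_toFinset] at ht ⊢
    rwa [← hT, Set.inv_mem_inv]
  · intro t ht
    rw [Set.mem_toFinset] at ht ⊢
    rwa [← hT, Set.inv_mem_inv]
  all_goals simp

theorem sum_char_eq_zero (hχ : χ ≠ 1) : ∑ h, (χ h : ℂ) = 0 := by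
  refine sum_hom_units_eq_zero ((Units.coeHom ℂ).comp χ) fun h => hχ ?_
  ext t
  simpa using DFunLike.congr_fun h t

variable {χ}

theorem sum_char_sq_eq_charSum (h3 : χ ^ 3 = 1) {T : Set H} (hT : T⁻¹ = T) :
    ∑ t ∈ T.toFinset, (χ t : ℂ) ^ 2 = charSum χ T := by
  rw [charSum_eq_sum_inv χ hT]
  exact Finset.sum_congr rfl fun t _ => char_sq_eq_inv h3 t

/-- Twice the sum of a cubic character over an inverse-closed set is an integer, because
`z + z⁻¹ ∈ {2, -1}` for every cube root of unity `z`. -/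
theorem exists_int_two_mul_charSum (h3 : χ ^ 3 = 1) {T : Set H} (hT : T⁻¹ = T) :
    ∃ A : ℤ, 2 * charSum χ T = A := by
  refine ⟨∑ t ∈ T.toFinset, if (χ t : ℂ) = 1 then 2 else -1, ?_⟩
  rw [two_mul]
  nth_rewrite 2 [charSum_eq_sum_inv χ hT]
  rw [charSum, ← Finset.sum_add_distrib, Int.cast_sum]
  refine Finset.sum_congr rfl fun t _ => ?_
  have hsq := char_sq_eq_inv h3 t
  have hne := (χ t).ne_zero
  split_ifs with h
  · rw [h]; norm_num
  · rw [← hsq]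
    have hcube : (χ t : ℂ) ^ 3 = 1 := by
      rw [pow_succ, hsq, inv_mul_cancel₀ hne]
    have : ((χ t : ℂ) - 1) * (χ t + (χ t : ℂ) ^ 2 + 1) = 0 := by linear_combination hcube
    rcases mul_eq_zero.1 this with h1 | h1
    · exact absurd (sub_eq_zero.1 h1) h
    · push_cast
      linear_combination h1

theorem APLLEqs.charSum_mul_charSum {n : ℕ} {T₀ T₁ : Set H} (h : APLLEqs n T₀ T₁) (hχ : χ ≠ 1) :
    charSum χ T₀ * charSum χ T₁ = -1 := by
  have hcoeff (g : H) : ((if g = 1 then 0 else 1 : ℕ) : ℂ) * (χ g : ℂ)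
      = χ g - if g = 1 then 1 else 0 := by
    split_ifs with hg <;> simp [hg]
  rw [← sum_ncard_prod_mul_char]
  simp_rw [h.1, hcoeff, Finset.sum_sub_distrib, sum_char_eq_zero χ hχ]
  simp

theorem APLLEqs.charSum_sq_add {n : ℕ} {T₀ T₁ : Set H} (h : APLLEqs n T₀ T₁) (hχ : χ ≠ 1) :
    charSum χ T₀ * charSum χ T₀ + charSum χ T₁ * charSum χ T₁
      + ∑ t ∈ T₀.toFinset, (χ t : ℂ) ^ 2 + ∑ t ∈ T₁.toFinset, (χ t : ℂ) ^ 2 = 2 * n := by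
  have hcoeff (g : H) : ((2 + if g = 1 then 2 * n else 0 : ℕ) : ℂ) * (χ g : ℂ)
      = 2 * χ g + if g = 1 then 2 * (n : ℂ) else 0 := by
    split_ifs with hg
    · simp [hg]
    · simp
  simp_rw [← sum_ncard_prod_mul_char, ← sum_ncard_sq_mul_char, ← Finset.sum_add_distrib, ← add_mul,
    ← Nat.cast_add, h.2, hcoeff, Finset.sum_add_distrib, ← Finset.mul_sum, sum_char_eq_zero χ hχ]
  simp

end

theorem exists_cubic_char {H : Type*} [CommGroup H] [Fintype H] (h : 3 ∣ Fintype.card H) :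
    ∃ χ : H →* ℂˣ, χ ≠ 1 ∧ χ ^ 3 = 1 := by
  have hcard : 3 ∣ Nat.card (H →* ℂˣ) := by
    rwa [CommGroup.card_monoidHom_of_hasEnoughRootsOfUnity, Nat.card_eq_fintype_card]
  obtain ⟨e⟩ := CommGroup.monoidHom_mulEquiv_of_hasEnoughRootsOfUnity H ℂ
  have : Finite (H →* ℂˣ) := Finite.of_equiv H e.symm.toEquiv
  have : Fact (Nat.Prime 3) := ⟨Nat.prime_three⟩
  obtain ⟨χ, hχ⟩ := exists_prime_orderOf_dvd_card' 3 hcard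
  refine ⟨χ, fun h1 => ?_, hχ ▸ pow_orderOf_eq_one χ⟩
  simp [h1] at hχ

/-- When `3` divides the order of the group, a cubic character forces `n = 1`. -/
theorem APLLEqs.eq_one {n : ℕ} {H : Type*} [CommGroup H] [Fintype H] (h3 : 3 ∣ Fintype.card H)
    {T₀ T₁ : Set H} (hT₀ : T₀⁻¹ = T₀) (hT₁ : T₁⁻¹ = T₁) (h : APLLEqs n T₀ T₁) : n = 1 := by
  obtain ⟨χ, hχ, hχ3⟩ := exists_cubic_char h3
  have hprod := h.charSum_mul_charSum hχ
  have hsum := h.charSum_sq_add hχ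
  rw [sum_char_sq_eq_charSum hχ3 hT₀, sum_char_sq_eq_charSum hχ3 hT₁] at hsum
  obtain ⟨A, hA⟩ := exists_int_two_mul_charSum hχ3 hT₀
  obtain ⟨B, hB⟩ := exists_int_two_mul_charSum hχ3 hT₁
  have hAB : A * B = -4 := by
    have : (A * B : ℂ) = -4 := by
      rw [← hA, ← hB]; linear_combination 4 * hprod
    exact_mod_cast this
  have hS : A * A + B * B + 2 * A + 2 * B = 8 * n := by
    have : (A * A + B * B + 2 * A + 2 * B : ℂ) = 8 * n := by
      rw [← hA, ← hB]; linear_combination 4 * hsum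
    exact_mod_cast this
  have hdvd : A ∣ 4 := ⟨-B, by linarith⟩
  have hle : A ≤ 4 := Int.le_of_dvd (by norm_num) hdvd
  have hge : -A ≤ 4 := Int.le_of_dvd (by norm_num) (by rwa [neg_dvd])
  have hge' : -4 ≤ A := by linarith
  interval_cases A
  all_goals
    obtain rfl | rfl | rfl | rfl | rfl | rfl : B = -4 ∨ B = -2 ∨ B = -1 ∨ B = 1 ∨ B = 2 ∨ B = 4 := by
      omega
  all_goals omega

/-- Nonexistence of inverse-closed subsets `T₀, T₁` with `e ∈ T₀` satisfying the
APLL group-ring equations, in any finite abelian group of order `n²+n+1`. -/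
theorem no_APLL_subsets_ge125_2mod5_1mod6 (n : ℕ) (hn : 0 < n)
    (hge : 125 ≤ n) (h5 : n % 5 = 2) (h6 : n % 6 = 1)
    (H : Type*) [CommGroup H] [Fintype H]
    (hcard : Fintype.card H = n ^ 2 + n + 1) :
    ¬ ∃ T₀ T₁ : Set H,
        T₀⁻¹ = T₀ ∧ T₁⁻¹ = T₁ ∧ (1 : H) ∈ T₀ ∧ APLLEqs n T₀ T₁ := by
  rintro ⟨T₀, T₁, hT₀, hT₁, -, h⟩
  have h3 : 3 ∣ Fintype.card H := by
    have hmod : n % 3 = 1 := by omega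
    rw [hcard, Nat.dvd_iff_mod_eq_zero]
    simp [Nat.add_mod, Nat.pow_mod, hmod]
  have := h.eq_one h3 hT₀ hT₁
  omega
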